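/- arXiv:2304.01105 — 2 statements merged into one kernel-verified Lean document; each statement's English description precedes it below -/
import Mathlib

section
/- Let $d \ge 1$ and let $\hat\Phi \in \mathrm{GL}_n(\hat{\mathbb{Z}})$ have determinant $\pm 1$ and first column equal to $(\varepsilon, 0, \dots, 0)^T$ with $\varepsilon \in \{1,-1\}$. Then there exists $\Phi \in \mathrm{GL}_n(\mathbb{Z})$ with $\Phi \equiv \hat\Phi \pmod d$ whose first column is also $(\varepsilon, 0, \dots, 0)^T$. -/
open Matrix

/-- The profinite completion `Ẑ = lim ℤ/N` realised as the subring of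
compatible families in `∏ N, ℤ/N`. -/
def ZHatSubring : Subring (∀ N : ℕ+, ZMod N) where
  carrier := {f | ∀ (M N : ℕ+) (h : (M : ℕ) ∣ (N : ℕ)),
    ZMod.castHom h (ZMod M) (f N) = f M}
  zero_mem' := by intro M N h; exact map_zero (ZMod.castHom h (ZMod M))
  one_mem' := by intro M N h; exact map_one (ZMod.castHom h (ZMod M))
  add_mem' := by intro a b ha hb M N h; simp [map_add, ha M N h, hb M N h]
  neg_mem' := by intro a ha M N h; simp [map_neg, ha M N h]
  mul_mem' := by intro a b ha hb M N h; simp [_root_.map_mul, ha M N h, hb M N h]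

/-- The profinite integers. -/
abbrev ZHat : Type := ZHatSubring

/-- The canonical projection `Ẑ → ℤ/c`. -/
def ZHat.proj (c : ℕ+) : ZHat →+* ZMod c :=
  (Pi.evalRingHom (fun N : ℕ+ => ZMod N) c).comp ZHatSubring.subtype


theorem aux_det {R : Type*} [CommRing R] {m : ℕ} (M : Matrix (Fin (m+1)) (Fin (m+1)) R) (e : R)
    (h : ∀ i, M i 0 = if i = 0 then e else 0) :
    M.det = e * (M.submatrix Fin.succ Fin.succ).det := by
  rw [Matrix.det_succ_column_zero, Fin.sum_univ_succ]
  have : ∀ i : Fin m, M i.succ 0 = 0 := fun i => by rw [h]; simp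
  simp only [this, h 0]
  simp

/-- Assemble a block upper triangular lift. -/
theorem aux_block {d : ℕ} {m : ℕ} (M : Matrix (Fin (m+1)) (Fin (m+1)) (ZMod d)) (e : ℤ)
    (h : ∀ i, M i 0 = if i = 0 then (e : ZMod d) else 0)
    (B : Matrix (Fin m) (Fin m) ℤ)
    (hB : ∀ i j, (B i j : ZMod d) = M i.succ j.succ) :
    ∃ C : Matrix (Fin (m+1)) (Fin (m+1)) ℤ, C.det = e * B.det ∧
      (∀ i j, (C i j : ZMod d) = M i j) ∧ ∀ i, C i 0 = if i = 0 then e else 0 := by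
  have hc : ∀ x : ZMod d, ∃ y : ℤ, (y : ZMod d) = x := ZMod.intCast_surjective
  choose f hf using hc
  let C : Matrix (Fin (m+1)) (Fin (m+1)) ℤ := Matrix.of fun i j =>
    (Fin.cases (Fin.cases e (fun j => f (M 0 j.succ)) j)
      (fun i => Fin.cases 0 (fun j => B i j) j) i : ℤ)
  have h0 : ∀ i, C i 0 = if i = 0 then e else 0 := by
    intro i
    cases i using Fin.cases <;> simp [C]
  refine ⟨C, ?_, ?_, h0⟩
  · rw [aux_det C e h0]
    rfl
  · intro i j
    cases j using Fin.cases with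
    | zero => rw [h0, h]; split_ifs <;> simp
    | succ j =>
      cases i using Fin.cases with
      | zero => simp [C, hf]
      | succ i => simp [C, hB]

theorem aux_tv {R : Type*} [CommRing R] {m : ℕ} (i j : Fin m) (c : R) (v : Fin m → R) (k : Fin m) :
    (transvection i j c *ᵥ v) k = v k + if k = i then c * v j else 0 := by
  simp [transvection, Matrix.add_mulVec]
  by_cases h : k = i
  · subst h
    simp [Matrix.mulVec, dotProduct, Matrix.single_apply]
  · simp [Matrix.mulVec, dotProduct, Matrix.single_apply, h, Ne.symm h]

theorem aux_reduce {m : ℕ} (N : ℕ) : ∀ v : Fin m → ℤ, ∑ i, (v i).natAbs = N →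
    ∃ U : Matrix (Fin m) (Fin m) ℤ, U.det = 1 ∧
      ∀ i j, i ≠ j → (U *ᵥ v) i = 0 ∨ (U *ᵥ v) j = 0 := by
  induction N using Nat.strong_induction_on with
  | _ N ih =>
  intro v hv
  by_cases hall : ∀ i j, i ≠ j → v i = 0 ∨ v j = 0
  · exact ⟨1, by simp, by simpa using hall⟩
  push Not at hall
  have : ∃ i j, i ≠ j ∧ v i ≠ 0 ∧ v j ≠ 0 ∧ (v j).natAbs ≤ (v i).natAbs := by
    obtain ⟨i, j, hij, hi, hj⟩ := hall
    rcases le_total (v j).natAbs (v i).natAbs with h | h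
    · exact ⟨i, j, hij, hi, hj, h⟩
    · exact ⟨j, i, hij.symm, hj, hi, h⟩
  obtain ⟨i, j, hij, hi, hj, hle⟩ := this
  have hc : ∃ c : ℤ, (v i + c * v j).natAbs < (v i).natAbs := by
    refine ⟨-(v i / v j), ?_⟩
    have h1 : v i + -(v i / v j) * v j = v i % v j := by
      have := Int.emod_add_mul_ediv (v i) (v j)
      linarith
    rw [h1]
    have h2 := Int.emod_nonneg (v i) hj
    have h3 := Int.emod_lt_abs (v i) hj
    rw [Int.abs_eq_natAbs] at h3
    clear hv hall h1
    omega
  obtain ⟨c, hc⟩ := hc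
  have hlt : ∑ k, ((transvection i j c *ᵥ v) k).natAbs < N := by
    rw [← hv]
    apply Finset.sum_lt_sum
    · intro k _
      rw [aux_tv]
      split_ifs with h
      · subst h; exact hc.le
      · simp
    · exact ⟨i, Finset.mem_univ _, by rw [aux_tv]; simpa using hc⟩
  obtain ⟨U, hU, hU2⟩ := ih _ hlt _ rfl
  refine ⟨U * transvection i j c, ?_, ?_⟩
  · rw [Matrix.det_mul, hU, Matrix.det_transvection_of_ne _ _ hij, one_mul]
  · simpa [Matrix.mulVec_mulVec] using hU2

/-- The matrix `M` lifts to an integer matrix of determinant one. -/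
def AuxLift {d m : ℕ} (M : Matrix (Fin m) (Fin m) (ZMod d)) : Prop :=
  ∃ B : Matrix (Fin m) (Fin m) ℤ, B.det = 1 ∧ B.map (Int.castRingHom (ZMod d)) = M

theorem aux_lift_mul {d m : ℕ} (M : Matrix (Fin m) (Fin m) (ZMod d))
    (U : Matrix (Fin m) (Fin m) ℤ) (hU : U.det = 1)
    (h : AuxLift (U.map (Int.castRingHom (ZMod d)) * M)) : AuxLift M := by
  obtain ⟨C, hC, hC2⟩ := h
  refine ⟨U.adjugate * C, ?_, ?_⟩
  · rw [Matrix.det_mul, Matrix.det_adjugate, hU, hC]; simp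
  · rw [Matrix.map_mul, hC2, ← Matrix.mul_assoc, ← Matrix.map_mul, Matrix.adjugate_mul, hU]
    simp

theorem aux_tv_lift {d m : ℕ} (M : Matrix (Fin m) (Fin m) (ZMod d))
    (i j : Fin m) (hij : i ≠ j) (c : ZMod d)
    (h : AuxLift (transvection i j c * M)) : AuxLift M := by
  obtain ⟨c, rfl⟩ := ZMod.intCast_surjective c
  refine aux_lift_mul M (transvection i j c) (Matrix.det_transvection_of_ne _ _ hij _) ?_
  convert h using 2
  ext a b
  simp [transvection, Matrix.single_apply, Matrix.one_apply]

theorem aux_tv_mul {R : Type*} [CommRing R] {m : ℕ} (i j : Fin m) (c : R)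
    (M : Matrix (Fin m) (Fin m) R) (k l : Fin m) :
    (transvection i j c * M) k l = M k l + if k = i then c * M j l else 0 := by
  have := aux_tv i j c (fun a => M a l) k
  rw [← this]
  rfl

theorem aux_SL {d : ℕ} : ∀ m : ℕ, ∀ M : Matrix (Fin m) (Fin m) (ZMod d), M.det = 1 → AuxLift M := by
  intro m
  induction m with
  | zero => intro M _; exact ⟨1, by simp, by ext i; exact i.elim0⟩
  | succ m ih =>
  -- first column already standard
  have base : ∀ M : Matrix (Fin (m+1)) (Fin (m+1)) (ZMod d), M.det = 1 →
      (∀ i, M i 0 = if i = 0 then 1 else 0) → AuxLift M := by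
    intro M hM h
    have h1 := aux_det M 1 h
    rw [hM, one_mul] at h1
    obtain ⟨B, hB, hB2⟩ := ih _ h1.symm
    obtain ⟨C, hC, hC2, -⟩ := aux_block M 1 (by simpa using h) B (by
      intro i j
      have := congrFun (congrFun hB2 i) j
      simpa using this)
    exact ⟨C, by rw [hC, hB, one_mul], by ext i j; simpa using hC2 i j⟩
  -- first column with a one at the top
  have det_tv : ∀ (M : Matrix (Fin (m+1)) (Fin (m+1)) (ZMod d)) i j c, i ≠ j → M.det = 1 →
      (transvection i j c * M).det = 1 := by
    intro M i j c hij hM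
    rw [Matrix.det_mul, Matrix.det_transvection_of_ne _ _ hij, hM, one_mul]
  -- two units in positions 0 and k
  have two : ∀ M : Matrix (Fin (m+1)) (Fin (m+1)) (ZMod d), M.det = 1 → ∀ k, k ≠ 0 →
      IsUnit (M k 0) → (∀ i, i ≠ 0 → i ≠ k → M i 0 = 0) → AuxLift M := by
    intro M hM k hk hu h0
    obtain ⟨b, hb⟩ := hu.exists_left_inv
    refine aux_tv_lift M 0 k hk.symm ((1 - M 0 0) * b) ?_
    have hM1 := det_tv M 0 k ((1 - M 0 0) * b) hk.symm hM
    refine aux_tv_lift _ k 0 hk (- M k 0) ?_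
    refine base _ (det_tv _ k 0 _ hk hM1) ?_
    intro i
    have e0 : (transvection 0 k ((1 - M 0 0) * b) * M) 0 0 = 1 := by
      rw [aux_tv_mul, if_pos rfl, mul_assoc, hb]; ring
    rw [aux_tv_mul, e0]
    by_cases hi : i = 0
    · subst hi
      rw [e0, if_neg hk.symm]; simp
    · rw [aux_tv_mul, if_neg hi, if_neg hi]
      by_cases hik : i = k
      · subst hik; simp
      · simp [hik, h0 i hi hik]
  intro M hM
  choose v hv using fun i => ZMod.intCast_surjective (M i 0)
  obtain ⟨U, hU, hU2⟩ := aux_reduce _ v rfl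
  refine aux_lift_mul M U hU ?_
  set M' := U.map (Int.castRingHom (ZMod d)) * M with hM'
  have hdet : M'.det = 1 := by
    have : (U.map (Int.castRingHom (ZMod d))).det = 1 := by
      have := (Int.castRingHom (ZMod d)).map_det U
      rw [hU, map_one] at this
      exact this.symm
    rw [hM', Matrix.det_mul, this, hM, one_mul]
  have hcol : ∀ i, M' i 0 = ((U *ᵥ v) i : ℤ) := by
    intro i
    simp [hM', Matrix.mul_apply, Matrix.mulVec, dotProduct, hv]
  obtain ⟨k, hk⟩ : ∃ k, ∀ j, j ≠ k → M' j 0 = 0 := by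
    by_cases h : ∃ k, (U *ᵥ v) k ≠ 0
    · obtain ⟨k, hk⟩ := h
      refine ⟨k, fun j hj => ?_⟩
      rw [hcol, (hU2 j k hj).resolve_right hk, Int.cast_zero]
    · push Not at h
      exact ⟨0, fun j _ => by rw [hcol, h, Int.cast_zero]⟩
  have hunit : IsUnit (M' k 0) := by
    have h1 := Matrix.det_succ_column_zero M'
    rw [hdet, Finset.sum_eq_single k (fun j _ hj => by rw [hk j hj]; ring) (by simp)] at h1
    refine IsUnit.of_mul_eq_one ((-1) ^ (k : ℕ) * (M'.submatrix k.succAbove Fin.succ).det) ?_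
    refine Eq.trans ?_ h1.symm
    ring
  by_cases hk0 : k = 0
  · subst hk0
    rcases m with _ | m
    · refine base _ hdet ?_
      intro i
      have : i = 0 := by omega
      subst this
      rw [← hdet, Matrix.det_fin_one]; simp
    · have h10 : (1 : Fin (m+1+1)) ≠ 0 := by simp
      refine aux_tv_lift M' 1 0 h10 1 ?_
      refine two _ (det_tv _ _ _ _ h10 hdet) 1 h10 ?_ ?_
      · rw [aux_tv_mul, hk 1 h10]; simpa using hunit
      · intro i hi hi1
        rw [aux_tv_mul, hk i hi, if_neg hi1, add_zero]
  · exact two _ hdet k hk0 hunit fun i _ hik => hk i hik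

theorem aux_pm {d m : ℕ} (M : Matrix (Fin m) (Fin m) (ZMod d)) (hM : M.det = 1 ∨ M.det = -1) :
    ∃ B : Matrix (Fin m) (Fin m) ℤ, IsUnit B.det ∧ ∀ i j, (B i j : ZMod d) = M i j := by
  rcases m with _ | m
  · exact ⟨1, by simp, fun i => i.elim0⟩
  rcases hM with hM | hM
  · obtain ⟨B, hB, hB2⟩ := aux_SL _ M hM
    refine ⟨B, by simp [hB], fun i j => ?_⟩
    rw [← hB2]; simp
  · obtain ⟨B, hB, hB2⟩ := aux_SL _ (M.updateRow 0 (-M 0)) (by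
      have := Matrix.det_updateRow_smul M 0 (-1) (M 0)
      simp only [neg_smul, one_smul, Matrix.updateRow_eq_self, hM] at this
      rw [this]; ring)
    refine ⟨B.updateRow 0 (-B 0), ?_, fun i j => ?_⟩
    · have := Matrix.det_updateRow_smul B 0 (-1) (B 0)
      simp only [neg_smul, one_smul, Matrix.updateRow_eq_self, hB] at this
      rw [this]; simp
    · have := congrFun (congrFun hB2 i) j
      by_cases hi : i = 0
      · subst hi
        simp at this
        simp [this]
      · simpa [Matrix.updateRow_apply, hi] using this

/-- If `Φ̂ ∈ GL n (Ẑ)` has determinant `±1` and first column `(ε, 0, …, 0)ᵀ`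
with `ε = ±1`, then there is `Φ ∈ GL n (ℤ)` congruent to `Φ̂` mod `d` whose
first column is also `(ε, 0, …, 0)ᵀ`. -/
theorem stmt_4 (n : ℕ) [NeZero n] (d : ℕ+)
    (Φhat : Matrix.GeneralLinearGroup (Fin n) ZHat) (ε : ℤ)
    (hε : ε = 1 ∨ ε = -1)
    (hdet : (Φhat : Matrix (Fin n) (Fin n) ZHat).det = 1 ∨
            (Φhat : Matrix (Fin n) (Fin n) ZHat).det = -1)
    (hcol : ∀ i : Fin n, (Φhat : Matrix (Fin n) (Fin n) ZHat) i 0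
      = if i = 0 then (ε : ZHat) else 0) :
    ∃ Φ : Matrix.GeneralLinearGroup (Fin n) ℤ,
      (∀ i j : Fin n, (((Φ : Matrix (Fin n) (Fin n) ℤ) i j : ℤ) : ZMod d)
          = ZHat.proj d ((Φhat : Matrix (Fin n) (Fin n) ZHat) i j)) ∧
      (∀ i : Fin n, (Φ : Matrix (Fin n) (Fin n) ℤ) i 0
          = if i = 0 then ε else 0) := by
  obtain ⟨m, rfl⟩ : ∃ m, n = m + 1 := ⟨n - 1, by have := NeZero.ne n; omega⟩
  set M : Matrix (Fin (m+1)) (Fin (m+1)) (ZMod d) :=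
    (Φhat : Matrix (Fin (m+1)) (Fin (m+1)) ZHat).map (ZHat.proj d) with hMdef
  have hM0 : ∀ i, M i 0 = if i = 0 then (ε : ZMod d) else 0 := by
    intro i
    have := congrArg (ZHat.proj d) (hcol i)
    rw [apply_ite (ZHat.proj d), map_intCast, map_zero] at this
    exact this
  have hMd : M.det = 1 ∨ M.det = -1 := by
    have h1 : M.det = ZHat.proj d (Φhat : Matrix (Fin (m+1)) (Fin (m+1)) ZHat).det :=
      ((ZHat.proj d).map_det _).symm
    rcases hdet with h | h
    · left; rw [h1, h, map_one]
    · right; rw [h1, h, map_neg, map_one]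
  have hB : (M.submatrix Fin.succ Fin.succ).det = 1 ∨ (M.submatrix Fin.succ Fin.succ).det = -1 := by
    rw [aux_det M _ hM0] at hMd
    rcases hε with rfl | rfl
    · simpa using hMd
    · simp only [Int.cast_neg, Int.cast_one, neg_mul, one_mul, neg_inj] at hMd
      rcases hMd with h | h
      · right; rw [← h, neg_neg]
      · left; exact h
  obtain ⟨B, hBu, hB2⟩ := aux_pm _ hB
  obtain ⟨C, hC, hC2, hC3⟩ := aux_block M ε hM0 B hB2
  have hCu : IsUnit C.det := by
    rw [hC]
    refine IsUnit.mul ?_ hBu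
    rcases hε with rfl | rfl <;> simp
  exact ⟨Matrix.GeneralLinearGroup.mk'' C hCu, fun i j => hC2 i j, fun i => hC3 i⟩
end

section
/- Let $2 \le n$, let $d_1 \mid d_2 \mid \cdots \mid d_{m}$ be positive integers, and suppose $[A],[B]$ are elements of $\mathbb{Z}^n \oplus \bigoplus_{j=1}^{m-1}(\mathbb{Z}/d_j)^n$ with $\hat\Phi \cdot [A] = [B]$ for some $\hat\Phi \in \mathrm{GL}_n(\hat{\mathbb{Z}})$ acting diagonally on each summand (via $\hat{\mathbb{Z}} \to \mathbb{Z}$-span identifications and reduction mod $d_j$, requiring $\hat\Phi$ to preserve the integer lattice on the free part). If either $n > m$ or $d_{m-(n-1)} \in \{1,2,3,4,6\}$, then there exists $\Phi \in \mathrm{GL}_n(\mathbb{Z})$ with $\Phi\cdot[A] = [B]$. -/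
open Matrix

theorem aux_coprime (x v a g b N : ℤ) (h : x * v + a * g + b * N = 1) (hg : g ≠ 0) :
    ∃ s : ℤ, IsCoprime (v + s * N) g := by
  classical
  refine ⟨((∏ p ∈ g.natAbs.primeFactors.filter (fun p : ℕ => ¬ ((p : ℤ) ∣ v)), p : ℕ) : ℤ), ?_⟩
  rw [Int.isCoprime_iff_gcd_eq_one]
  by_contra hne
  obtain ⟨p, hp, hpd⟩ := Nat.exists_prime_and_dvd hne
  have hp' : Prime (p : ℤ) := Nat.prime_iff_prime_int.mp hp
  have h1 : (p : ℤ) ∣ _ := (Int.natCast_dvd_natCast.mpr hpd).trans (Int.gcd_dvd_left _ _)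
  have h2 : (p : ℤ) ∣ g := (Int.natCast_dvd_natCast.mpr hpd).trans (Int.gcd_dvd_right _ _)
  by_cases hv : (p : ℤ) ∣ v
  · have h3 := (Int.dvd_add_right hv).mp h1
    rcases hp'.dvd_or_dvd h3 with h4 | h4
    · rw [Int.natCast_dvd_natCast] at h4
      obtain ⟨q, hq, hpq⟩ := (Prime.dvd_finsetProd_iff hp.prime _).mp h4
      rw [Finset.mem_filter, Nat.mem_primeFactors] at hq
      have := (Nat.prime_dvd_prime_iff_eq hp hq.1.1).mp hpq
      subst this
      exact hq.2 hv
    · have : (p : ℤ) ∣ 1 := by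
        rw [← h]
        exact dvd_add (dvd_add (hv.mul_left _) (h2.mul_left _)) (h4.mul_left _)
      exact hp'.not_isUnit (isUnit_of_dvd_one this)
  · have h3 : p ∣ ∏ p ∈ g.natAbs.primeFactors.filter (fun p : ℕ => ¬ ((p : ℤ) ∣ v)), p := by
      apply Finset.dvd_prod_of_mem
      rw [Finset.mem_filter, Nat.mem_primeFactors]
      exact ⟨⟨hp, Int.natCast_dvd.mp h2, by simpa using hg⟩, hv⟩
    exact hv ((Int.dvd_add_left ((Int.natCast_dvd_natCast.mpr h3).mul_right _)).mp h1)

theorem aux_extract {ι : Type*} [Fintype ι] (v : ι → ℤ) (hv : v ≠ 0) :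
    ∃ (g : ℤ) (a u : ι → ℤ), g ≠ 0 ∧ v = g • a ∧ u ⬝ᵥ a = 1 := by
  have hne : (Finset.univ : Finset ι).Nonempty := by
    obtain ⟨i, -⟩ := Function.ne_iff.mp hv
    exact ⟨i, Finset.mem_univ _⟩
  obtain ⟨a, ha, ha1⟩ := Finset.extract_gcd v hne
  obtain ⟨u, hu⟩ := Finset.gcd_eq_sum_mul Finset.univ a
  have hva : v = (Finset.univ.gcd v) • a := by
    ext i; simpa using ha i (Finset.mem_univ _)
  refine ⟨_, a, u, ?_, hva, ?_⟩
  · intro h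
    rw [h] at hva
    simp at hva; exact hv hva
  · rw [ha1] at hu
    rw [dotProduct]
    simpa [mul_comm] using hu.symm

theorem aux_primLift (k N : ℕ) (hN : N ≠ 0) (v u : Fin (k+2) → ℤ) (t : ℤ)
    (h : u ⬝ᵥ v + t * N = 1) :
    ∃ v' u' : Fin (k+2) → ℤ, (∀ i, (v' i : ZMod N) = v i) ∧ u' ⬝ᵥ v' = 1 := by
  obtain ⟨w, hw0, hw⟩ : ∃ w : Fin (k+1) → ℤ, w ≠ 0 ∧ ∀ i, ∃ c, v i.succ = w i + c * N := by
    by_cases h0 : (fun i : Fin (k+1) => v i.succ) = 0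
    · refine ⟨fun _ => N, ?_, fun i => ⟨-1, ?_⟩⟩
      · intro h; have := congrFun h 0; simp at this; exact hN this
      · have := congrFun h0 i; simp at this; rw [this]; ring
    · exact ⟨_, h0, fun i => ⟨0, by simp⟩⟩
  choose c hc using hw
  obtain ⟨g, a, q, hg, hwa, hqa⟩ := aux_extract w hw0
  obtain ⟨s, x, y, hxy⟩ := aux_coprime (u 0) (v 0) (∑ i : Fin (k+1), u i.succ * a i) g
    (t + ∑ i : Fin (k+1), u i.succ * c i) N (by
      have h' := h
      rw [dotProduct, Fin.sum_univ_succ] at h'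
      rw [← h']
      simp only [hc, hwa, Pi.smul_apply, smul_eq_mul, add_mul, mul_add, Finset.sum_mul, Finset.sum_add_distrib]
      have e1 : ∀ i, u (Fin.succ i) * a i * g = u (Fin.succ i) * (g * a i) := fun i => by ring
      have e2 : ∀ i, u (Fin.succ i) * c i * N = u (Fin.succ i) * (c i * N) := fun i => by ring
      simp only [e1, e2]; ring) hg
  refine ⟨Fin.cons (v 0 + s * N) w, Fin.cons x (fun i => y * q i), ?_, ?_⟩
  · intro i
    refine Fin.cases ?_ (fun i => ?_) i
    · simp
    · simp [hc]
  · rw [dotProduct, Fin.sum_univ_succ]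
    simp only [Fin.cons_zero, Fin.cons_succ]
    rw [← hxy]
    congr 1
    have : y * g = y * g * (q ⬝ᵥ a) := by rw [hqa, mul_one]
    rw [this, dotProduct, Finset.mul_sum]
    refine Finset.sum_congr rfl fun i _ => ?_
    rw [hwa]; simp; ring

theorem aux_extend (k : ℕ) (v u : Fin (k+1) → ℤ) (h : u ⬝ᵥ v = 1) :
    ∃ P : Matrix (Fin (k+1)) (Fin (k+1)) ℤ, IsUnit P.det ∧ ∀ i, P i 0 = v i := by
  let φ : (Fin (k+1) → ℤ) →ₗ[ℤ] ℤ := dotProductBilin ℤ ℤ u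
  have hφ : ∀ x, φ x = u ⬝ᵥ x := fun x => rfl
  let b0 := Module.finBasis ℤ (LinearMap.ker φ)
  let b := Module.Basis.mkFinCons v b0 (by
      intro c x hx hcx
      have := congrArg φ hcx
      rw [map_add, map_smul, hφ v, h, LinearMap.mem_ker.mp hx] at this
      simpa using this) (by
      intro z
      refine ⟨-φ z, ?_⟩
      rw [LinearMap.mem_ker, map_add, map_smul, hφ v, h]; simp)
  have hr : Module.finrank ℤ (LinearMap.ker φ) + 1 = k + 1 := by
    have := Module.finrank_eq_card_basis b
    simpa using this.symm
  let b' := b.reindex (finCongr hr)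
  refine ⟨(Pi.basisFun ℤ (Fin (k+1))).toMatrix b', ?_, ?_⟩
  · rw [← Module.Basis.det_apply]
    exact Module.Basis.isUnit_det _ _
  · intro i
    have : b' 0 = v := by
      simp [b', b, Module.Basis.coe_mkFinCons]
    rw [Module.Basis.toMatrix_apply, this]; simp

theorem aux_orth {ι : Type*} [Fintype ι] (n : ℕ) (V : ι → Fin n → ℤ) (hc : Fintype.card ι < n) :
    ∃ w u : Fin n → ℤ, w ⬝ᵥ u = 1 ∧ ∀ i, w ⬝ᵥ V i = 0 := by
  have : ¬ Function.Injective (Matrix.toLin' (Matrix.of V)) := by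
    intro hi
    have := card_le_of_injective ℤ _ hi
    simp at this; omega
  rw [← LinearMap.ker_eq_bot, Submodule.eq_bot_iff] at this
  push Not at this
  obtain ⟨x, hx, hx0⟩ := this
  obtain ⟨g, a, u, hg, rfl, hu⟩ := aux_extract x hx0
  refine ⟨a, u, by rw [dotProduct_comm, hu], fun i => ?_⟩
  have := congrFun (LinearMap.mem_ker.mp hx) i
  rw [Matrix.toLin'_apply, Matrix.mulVec_smul] at this
  simp only [Pi.smul_apply, Pi.zero_apply, smul_eq_mul, mul_eq_zero, hg, false_or] at this
  rw [dotProduct_comm]; exact this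

theorem aux_liftFix (k N : ℕ)
    (IH : ∀ M : Matrix (Fin k) (Fin k) ℤ, (∃ e : ℤˣ, (M.det : ZMod N) = ((e : ℤ) : ZMod N)) →
      ∃ M' : Matrix (Fin k) (Fin k) ℤ, IsUnit M'.det ∧ ∀ i j, (M' i j : ZMod N) = M i j)
    (M : Matrix (Fin (k+1)) (Fin (k+1)) ℤ)
    (hM : ∃ e : ℤˣ, (M.det : ZMod N) = ((e : ℤ) : ZMod N))
    (h0 : (M 0 0 : ZMod N) = 1) (h1 : ∀ i : Fin k, (M i.succ 0 : ZMod N) = 0) :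
    ∃ M' : Matrix (Fin (k+1)) (Fin (k+1)) ℤ, IsUnit M'.det ∧
      (∀ i j, (M' i j : ZMod N) = M i j) ∧ ∀ i, M' i 0 = (Pi.single 0 1 : Fin (k+1) → ℤ) i := by
  obtain ⟨e, he⟩ := hM
  obtain ⟨M1, hu, hM1⟩ := IH (M.submatrix Fin.succ Fin.succ) ⟨e, by
    rw [← he]
    rw [Matrix.det_succ_column_zero M, Fin.sum_univ_succ]
    push_cast
    simp [h0, h1]⟩
  refine ⟨Matrix.of (Fin.cons (Fin.cons 1 (fun j => M 0 j.succ)) (fun i => Fin.cons 0 (M1 i))), ?_, ?_, ?_⟩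
  · rw [Matrix.det_succ_column_zero, Fin.sum_univ_succ]
    simp
    convert hu using 1
    congr 1
  · intro i j
    refine Fin.cases ?_ (fun i => ?_) i <;> refine Fin.cases ?_ (fun j => ?_) j <;> simp [h0, h1, hM1]
  · intro i
    refine Fin.cases ?_ (fun i => ?_) i <;> simp

theorem aux_castMul {k N : ℕ} (P M M' : Matrix (Fin k) (Fin k) ℤ)
    (h : ∀ i j, (M' i j : ZMod N) = M i j) (i j) :
    (((P * M') i j : ℤ) : ZMod N) = ((P * M) i j : ℤ) := by
  simp [Matrix.mul_apply, h]

theorem aux_castMul' {k N : ℕ} (P M M' : Matrix (Fin k) (Fin k) ℤ)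
    (h : ∀ i j, (M' i j : ZMod N) = M i j) (i j) :
    (((M' * P) i j : ℤ) : ZMod N) = ((M * P) i j : ℤ) := by
  simp [Matrix.mul_apply, h]

theorem aux_lift (N : ℕ) (hN : N ≠ 0) (k : ℕ) (M : Matrix (Fin (k+1)) (Fin (k+1)) ℤ)
    (hM : ∃ e : ℤˣ, (M.det : ZMod N) = ((e : ℤ) : ZMod N)) :
    ∃ M' : Matrix (Fin (k+1)) (Fin (k+1)) ℤ, IsUnit M'.det ∧
      ∀ i j, (M' i j : ZMod N) = M i j := by
  induction k with
  | zero =>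
    obtain ⟨e, he⟩ := hM
    refine ⟨Matrix.of fun _ _ => (e : ℤ), by simp, fun i j => ?_⟩
    fin_cases i; fin_cases j
    simpa using he.symm
  | succ k ih =>
    obtain ⟨e, he⟩ := hM
    have he' := he
    rw [ZMod.intCast_eq_intCast_iff] at he
    obtain ⟨t, ht⟩ := he.dvd
    have hadj : ∑ i, M.adjugate 0 i * M i 0 = M.det := by
      have := congrFun (congrFun (Matrix.adjugate_mul M) 0) 0
      simpa [Matrix.mul_apply] using this
    obtain ⟨v', u', hv, huv⟩ := aux_primLift k N hN (fun i => M i 0)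
      (fun i => (e : ℤ) * M.adjugate 0 i) (e * t) (by
        have h1 : (fun i => (e : ℤ) * M.adjugate 0 i) ⬝ᵥ (fun i => M i 0) = e * M.det := by
          rw [← hadj, Finset.mul_sum, dotProduct]
          exact Finset.sum_congr rfl fun i _ => by ring
        have h2 : (e : ℤ) * e = 1 := by
          rw [← Units.val_mul, Int.units_mul_self]; rfl
        rw [h1]
        linear_combination h2 - e * ht)
    obtain ⟨P, hP, hPv⟩ := aux_extend (k+1) v' u' huv
    have hcol : ∀ i, (((P⁻¹ * M) i 0 : ℤ) : ZMod N) = ((1 : Matrix (Fin (k+2)) (Fin (k+2)) ℤ) i 0 : ℤ) := by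
      intro i
      rw [← Matrix.nonsing_inv_mul P hP]
      simp only [Matrix.mul_apply, Int.cast_sum, Int.cast_mul, hPv, hv]
    have hdu : IsUnit (P⁻¹).det := Matrix.isUnit_nonsing_inv_det P hP
    obtain ⟨M', hu, hM', -⟩ := aux_liftFix (k+1) N ih (P⁻¹ * M)
      ⟨hdu.unit * e, by rw [Matrix.det_mul, Int.cast_mul, he', Units.val_mul, Int.cast_mul]; rfl⟩
      (by simpa using hcol 0) (fun i => by simpa using hcol i.succ)
    refine ⟨P * M', by rw [Matrix.det_mul]; exact hP.mul hu, fun i j => ?_⟩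
    rw [aux_castMul P _ _ hM', ← Matrix.mul_assoc, Matrix.mul_nonsing_inv P hP, Matrix.one_mul]

theorem aux_liftVec (N : ℕ) (hN : N ≠ 0) (k : ℕ) (M : Matrix (Fin (k+2)) (Fin (k+2)) ℤ)
    (hM : ∃ e : ℤˣ, (M.det : ZMod N) = ((e : ℤ) : ZMod N))
    (a ua b ub : Fin (k+2) → ℤ) (ha : ua ⬝ᵥ a = 1) (hb : ub ⬝ᵥ b = 1)
    (hab : ∀ i, (((M *ᵥ a) i : ℤ) : ZMod N) = b i) :
    ∃ M' : Matrix (Fin (k+2)) (Fin (k+2)) ℤ, IsUnit M'.det ∧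
      (∀ i j, (M' i j : ZMod N) = M i j) ∧ M' *ᵥ a = b := by
  obtain ⟨P, hP, hPa⟩ := aux_extend (k+1) a ua ha
  obtain ⟨Q, hQ, hQb⟩ := aux_extend (k+1) b ub hb
  have hPa' : P *ᵥ Pi.single 0 1 = a := by ext i; simp [hPa]
  have hQb' : Q *ᵥ Pi.single 0 1 = b := by ext i; simp [hQb]
  have hcol : ∀ i, (((Q⁻¹ * (M * P)) i 0 : ℤ) : ZMod N) = ((1 : Matrix (Fin (k+2)) (Fin (k+2)) ℤ) i 0 : ℤ) := by
    intro i
    have : ∀ j, (((M * P) j 0 : ℤ) : ZMod N) = Q j 0 := by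
      intro j
      rw [hQb, ← hab]
      simp [Matrix.mul_apply, Matrix.mulVec, dotProduct, hPa]
    rw [← Matrix.nonsing_inv_mul Q hQ, Matrix.mul_apply, Matrix.mul_apply]
    push_cast
    simp only [this]
  have hdQ : IsUnit (Q⁻¹).det := Matrix.isUnit_nonsing_inv_det Q hQ
  have hdP : IsUnit (P⁻¹).det := Matrix.isUnit_nonsing_inv_det P hP
  obtain ⟨e, he⟩ := hM
  obtain ⟨M', hu, hM', hc⟩ := aux_liftFix (k+1) N (aux_lift N hN k) (Q⁻¹ * (M * P))
      ⟨hdQ.unit * (e * hP.unit), by rw [Matrix.det_mul, Matrix.det_mul, Int.cast_mul, Int.cast_mul, he, Units.val_mul, Units.val_mul, Int.cast_mul, Int.cast_mul]; rfl⟩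
      (by simpa using hcol 0) (fun i => by simpa using hcol i.succ)
  have hc' : M' *ᵥ Pi.single 0 1 = Pi.single 0 1 := by ext i; simp [hc]
  refine ⟨Q * M' * P⁻¹, ?_, ?_, ?_⟩
  · rw [Matrix.det_mul, Matrix.det_mul]; exact (hQ.mul hu).mul hdP
  · intro i j
    rw [aux_castMul' P⁻¹ _ _ (aux_castMul Q _ _ hM')]
    rw [← Matrix.mul_assoc Q, Matrix.mul_nonsing_inv Q hQ, Matrix.one_mul, Matrix.mul_assoc,
      Matrix.mul_nonsing_inv P hP, Matrix.mul_one]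
  · rw [← hPa', ← hQb', Matrix.mulVec_mulVec, Matrix.mul_assoc, Matrix.nonsing_inv_mul P hP,
      Matrix.mul_one, ← Matrix.mulVec_mulVec, hc']

theorem aux_detfix {n : ℕ} (L D : ℕ) (hDL : D ∣ L) (F G : Matrix (Fin n) (Fin n) ℤ)
    (hFG : ((F.det * G.det : ℤ) : ZMod L) = 1) (e : ℤˣ) (he : (F.det : ZMod D) = ((e : ℤ) : ZMod D))
    (w u : Fin n → ℤ) (hwu : w ⬝ᵥ u = 1) :
    ∃ F' : Matrix (Fin n) (Fin n) ℤ, (F'.det : ZMod L) = ((e : ℤ) : ZMod L) ∧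
      (∀ x, w ⬝ᵥ x = 0 → F' *ᵥ x = F *ᵥ x) ∧
      ∀ c : ℕ, c ∣ D → ∀ x i, (((F' *ᵥ x) i : ℤ) : ZMod c) = ((F *ᵥ x) i : ℤ) := by
  have h2 : (e : ℤ) * e = 1 := by
    rw [← Units.val_mul, Int.units_mul_self]; rfl
  have hD1 : ((F.det * G.det : ℤ) : ZMod D) = 1 := by
    have := congrArg (ZMod.castHom hDL (ZMod D)) hFG
    rw [map_intCast, map_one] at this
    exact this
  have hk : ((e * G.det - 1 : ℤ) : ZMod D) = 0 := by
    rw [Int.cast_mul, he] at hD1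
    rw [Int.cast_sub, Int.cast_mul, hD1, Int.cast_one, sub_self]
  have hx : ∀ x, (F * (1 + replicateCol Unit ((e * G.det - 1 : ℤ) • u) * replicateRow Unit w)) *ᵥ x
      = F *ᵥ x + ((e * G.det - 1 : ℤ) * (w ⬝ᵥ x)) • (F *ᵥ u) := by
    intro x
    rw [← Matrix.mulVec_mulVec, Matrix.add_mulVec, Matrix.one_mulVec, Matrix.mulVec_add,
      ← Matrix.mulVec_smul]
    congr 2
    ext i
    simp [Matrix.mulVec, dotProduct, Matrix.mul_apply, Finset.mul_sum, Finset.sum_mul]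
    refine Finset.sum_congr rfl fun i _ => ?_
    ring
  refine ⟨F * (1 + replicateCol Unit ((e * G.det - 1 : ℤ) • u) * replicateRow Unit w), ?_, ?_, ?_⟩
  · rw [Matrix.det_mul, Matrix.det_one_add_replicateCol_mul_replicateRow, dotProduct_smul, hwu]
    have : F.det * (1 + (e * G.det - 1 : ℤ) • 1) = e * (F.det * G.det) := by
      simp; ring
    rw [this, Int.cast_mul, hFG, mul_one]
  · intro x h
    rw [hx, h]; simp
  · intro c hc x i
    have hk' : ((e * G.det - 1 : ℤ) : ZMod c) = 0 := by
      have := congrArg (ZMod.castHom hc (ZMod c)) hk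
      rw [map_intCast, map_zero] at this
      exact this
    rw [hx, Pi.add_apply, Pi.smul_apply, smul_eq_mul, Int.cast_add, Int.cast_mul, Int.cast_mul, hk']
    simp

theorem aux_unit (D : ℕ) (hD : D = 1 ∨ D = 2 ∨ D = 3 ∨ D = 4 ∨ D = 6) (x y : ℤ)
    (h : ((x * y : ℤ) : ZMod D) = 1) : ∃ e : ℤˣ, (x : ZMod D) = ((e : ℤ) : ZMod D) := by
  have key : (x : ZMod D) = 1 ∨ (x : ZMod D) = -1 := by
    rw [Int.cast_mul] at h
    generalize (x : ZMod D) = a at *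
    generalize (y : ZMod D) = b at *
    rcases hD with rfl | rfl | rfl | rfl | rfl <;> revert a b <;> decide
  rcases key with h | h
  · exact ⟨1, by simp [h]⟩
  · exact ⟨-1, by simp [h]⟩

theorem aux_int (k D0 : ℕ) (hD0 : D0 ≠ 0) {ι : Type} (dd : ι → ℕ) (hdd : ∀ j, dd j ∣ D0)
    (A B : Fin (k+2) → ℤ) (At : ι → Fin (k+2) → ℤ) (Bt : ∀ j, Fin (k+2) → ZMod (dd j))
    (S : ι → Prop) (w u : Fin (k+2) → ℤ) (hwu : w ⬝ᵥ u = 1) (hwA : w ⬝ᵥ A = 0)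
    (hwS : ∀ j, S j → w ⬝ᵥ At j = 0) (D : ℕ) (hDD : D ∣ D0)
    (hD : D = 1 ∨ D = 2 ∨ D = 3 ∨ D = 4 ∨ D = 6) (hS : ∀ j, ¬ S j → dd j ∣ D)
    (H : ∀ L : ℕ, L ≠ 0 → ∃ F G : Matrix (Fin (k+2)) (Fin (k+2)) ℤ,
      ((F.det * G.det : ℤ) : ZMod L) = 1 ∧ (∀ i, (((F *ᵥ A) i : ℤ) : ZMod L) = B i) ∧
      (∀ i, (((G *ᵥ B) i : ℤ) : ZMod L) = A i) ∧
      ∀ j, dd j ∣ L → ∀ i, (((F *ᵥ At j) i : ℤ) : ZMod (dd j)) = Bt j i) :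
    ∃ Φ : Matrix (Fin (k+2)) (Fin (k+2)) ℤ, IsUnit Φ.det ∧ Φ *ᵥ A = B ∧
      ∀ j i, (((Φ *ᵥ At j) i : ℤ) : ZMod (dd j)) = Bt j i := by
  -- determinant-fixed version of `H`
  have H' : ∀ L : ℕ, L ≠ 0 → D0 ∣ L → ∃ F : Matrix (Fin (k+2)) (Fin (k+2)) ℤ,
      (∃ e : ℤˣ, (F.det : ZMod L) = ((e : ℤ) : ZMod L)) ∧
      (∀ i, (((F *ᵥ A) i : ℤ) : ZMod L) = B i) ∧
      ∀ j i, (((F *ᵥ At j) i : ℤ) : ZMod (dd j)) = Bt j i := by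
    intro L hL hDL
    obtain ⟨F, G, hFG, hA, -, ht⟩ := H L hL
    have hFG' : ((F.det * G.det : ℤ) : ZMod D) = 1 := by
      have := congrArg (ZMod.castHom (hDD.trans hDL) (ZMod D)) hFG
      rw [map_intCast, map_one] at this
      exact this
    obtain ⟨e, he⟩ := aux_unit D hD _ _ hFG'
    obtain ⟨F', h1, h2, h3⟩ := aux_detfix L D (hDD.trans hDL) F G hFG e he w u hwu
    refine ⟨F', ⟨e, h1⟩, ?_, ?_⟩
    · rw [h2 A hwA]; exact hA
    · intro j i
      rw [← ht j ((hdd j).trans hDL)]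
      by_cases hj : S j
      · rw [h2 _ (hwS j hj)]
      · exact h3 _ (hS j hj) _ _
  have fin : ∀ F M : Matrix (Fin (k+2)) (Fin (k+2)) ℤ, (∀ i j, (M i j : ZMod D0) = F i j) →
      ∀ j i, (((M *ᵥ At j) i : ℤ) : ZMod (dd j)) = ((F *ᵥ At j) i : ℤ) := by
    intro F M h j i
    have : ∀ i l, (M i l : ZMod (dd j)) = F i l := by
      intro i l
      have := congrArg (ZMod.castHom (hdd j) (ZMod (dd j))) (h i l)
      simpa only [map_intCast] using this
    simp [Matrix.mulVec, dotProduct, this]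
  -- zero free parts correspond
  have hzero : ∀ x : Fin (k+2) → ℤ, (∀ L : ℕ, L ≠ 0 → ∀ i, (x i : ZMod L) = 0) → x = 0 := by
    intro x hx
    ext i
    have := hx ((x i).natAbs + 1) (by omega) i
    rw [ZMod.intCast_zmod_eq_zero_iff_dvd] at this
    exact Int.eq_zero_of_abs_lt_dvd this (by push_cast; omega)
  by_cases hA : A = 0
  · have hB : B = 0 := by
      apply hzero
      intro L hL i
      obtain ⟨F, G, -, h, -⟩ := H L hL
      rw [← h i, hA]; simp
    obtain ⟨F, he, -, ht⟩ := H' D0 hD0 dvd_rfl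
    obtain ⟨M, hu, hM⟩ := aux_lift D0 hD0 (k+1) F he
    refine ⟨M, hu, by rw [hA, hB]; simp, fun j i => ?_⟩
    rw [← ht j i, fin F M hM]
  · have hB : B ≠ 0 := by
      intro hB
      apply hA
      apply hzero
      intro L hL i
      obtain ⟨F, G, -, -, h, -⟩ := H L hL
      rw [← h i, hB]; simp
    obtain ⟨g, a, ua, hg, hAa, hua⟩ := aux_extract A hA
    obtain ⟨g', b', ub', hg', hBb', hub'⟩ := aux_extract B hB
    have hdiv : ∀ (M : Matrix (Fin (k+2)) (Fin (k+2)) ℤ) (x y z v : Fin (k+2) → ℤ) (c c' : ℤ) (l : ℕ),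
        x = c • y → v = c' • z → (∃ p, p ⬝ᵥ z = 1) → l = c.natAbs → (∀ i, (((M *ᵥ x) i : ℤ) : ZMod l) = v i) →
        c ∣ c' := by
      rintro M x y z v c c' l rfl rfl ⟨p, hp⟩ rfl h
      have h1 : ∀ i, c ∣ c' * z i := by
        intro i
        have := h i
        rw [Matrix.mulVec_smul, eq_comm, ZMod.intCast_eq_intCast_iff_dvd_sub] at this
        rw [Int.natCast_natAbs, abs_dvd] at this
        simp only [Pi.smul_apply, smul_eq_mul] at this
        have h3 := (dvd_sub_right (Dvd.intro ((M *ᵥ y) i) rfl)).mp this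
        exact h3
      have : c' = ∑ i, p i * (c' * z i) := by
        conv_lhs => rw [← mul_one c', ← hp, dotProduct, Finset.mul_sum]
        exact Finset.sum_congr rfl fun i _ => by ring
      rw [this]
      exact Finset.dvd_sum fun i _ => (h1 i).mul_left _
    have hgg' : g ∣ g' := by
      obtain ⟨F, G, -, h, -⟩ := H g.natAbs (by simpa using hg)
      exact hdiv F A a b' B g g' _ hAa hBb' ⟨_, hub'⟩ rfl h
    have hg'g : g' ∣ g := by
      obtain ⟨F, G, -, -, h, -⟩ := H g'.natAbs (by simpa using hg')
      exact hdiv G B b' a A g' g _ hBb' hAa ⟨_, hua⟩ rfl h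
    obtain ⟨b, ub, hBb, hub⟩ : ∃ b ub : Fin (k+2) → ℤ, B = g • b ∧ ub ⬝ᵥ b = 1 := by
      rcases Int.associated_iff.mp (associated_of_dvd_dvd hgg' hg'g) with h | h
      · exact ⟨b', ub', by rw [h, hBb'], hub'⟩
      · exact ⟨-b', -ub', by rw [h, hBb']; simp, by simpa using hub'⟩
    obtain ⟨F, he, hFA, ht⟩ := H' (g.natAbs * D0) (by simp [hg, hD0]) (Dvd.intro_left _ rfl)
    have he' : ∃ e : ℤˣ, (F.det : ZMod D0) = ((e : ℤ) : ZMod D0) := by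
      obtain ⟨e, he⟩ := he
      refine ⟨e, ?_⟩
      have := congrArg (ZMod.castHom (Dvd.intro_left g.natAbs rfl : D0 ∣ g.natAbs * D0) (ZMod D0)) he
      simpa only [map_intCast] using this
    have hab : ∀ i, (((F *ᵥ a) i : ℤ) : ZMod D0) = b i := by
      intro i
      have := hFA i
      rw [hAa, hBb, Matrix.mulVec_smul, ZMod.intCast_eq_intCast_iff_dvd_sub] at this
      rw [ZMod.intCast_eq_intCast_iff_dvd_sub]
      simp only [Pi.smul_apply, smul_eq_mul] at this
      rw [← mul_sub] at this
      obtain ⟨c, hc⟩ := this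
      have h1 : g * (D0 : ℤ) ∣ (g.natAbs * D0 : ℕ) := by
        push_cast
        exact mul_dvd_mul (by simp) dvd_rfl
      exact (mul_dvd_mul_iff_left hg).mp (h1.trans ⟨c, hc⟩)
    obtain ⟨M, hu, hM, hMa⟩ := aux_liftVec D0 hD0 k F he' a ua b ub hua hub hab
    refine ⟨M, hu, by rw [hAa, hBb, Matrix.mulVec_smul, hMa], fun j i => ?_⟩
    rw [← ht j i, fin F M hM]

/-- If `[A], [B] ∈ ℤⁿ ⊕ ⊕_{j=1}^{m-1} (ℤ/d_j)ⁿ` (with `d₁ ∣ ⋯ ∣ d_m`) are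
related by the componentwise action of some `Φ̂ ∈ GL n (Ẑ)` preserving the
integer lattice on the free part, and if `n > m` or `d_{m-(n-1)} ∈ {1,2,3,4,6}`,
then they are related by some `Φ ∈ GL n (ℤ)`. -/
theorem stmt_19 (n m : ℕ) (hn : 2 ≤ n) (d : Fin m → ℕ+)
    (hchain : ∀ i j : Fin m, i ≤ j → (d i : ℕ) ∣ (d j : ℕ))
    (Afree Bfree : Fin n → ℤ)
    (Ator Btor : ∀ j : Fin (m - 1), Fin n → ZMod (d (Fin.castLE (Nat.sub_le m 1) j)))
    (Φhat : Matrix.GeneralLinearGroup (Fin n) ZHat)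
    (hfree : ∀ i : Fin n,
      ∑ j', (Φhat : Matrix (Fin n) (Fin n) ZHat) i j' * ((Afree j' : ℤ) : ZHat)
        = ((Bfree i : ℤ) : ZHat))
    (htor : ∀ (j : Fin (m - 1)) (i : Fin n),
      ∑ j', ZHat.proj (d (Fin.castLE (Nat.sub_le m 1) j))
          ((Φhat : Matrix (Fin n) (Fin n) ZHat) i j') * Ator j j'
        = Btor j i)
    (hcase : m < n ∨ ∃ hj : m - n < m,
      ((d ⟨m - n, hj⟩ : ℕ) = 1 ∨ (d ⟨m - n, hj⟩ : ℕ) = 2 ∨ (d ⟨m - n, hj⟩ : ℕ) = 3 ∨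
        (d ⟨m - n, hj⟩ : ℕ) = 4 ∨ (d ⟨m - n, hj⟩ : ℕ) = 6)) :
    ∃ Φ : Matrix.GeneralLinearGroup (Fin n) ℤ,
      (∀ i : Fin n, ∑ j', (Φ : Matrix (Fin n) (Fin n) ℤ) i j' * Afree j' = Bfree i) ∧
      (∀ (j : Fin (m - 1)) (i : Fin n),
        ∑ j', (((Φ : Matrix (Fin n) (Fin n) ℤ) i j' : ℤ) :
            ZMod (d (Fin.castLE (Nat.sub_le m 1) j))) * Ator j j'
          = Btor j i) := by
  classical
  obtain ⟨k, rfl⟩ : ∃ k, n = k + 2 := ⟨n - 2, by omega⟩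
  let dd : Fin (m - 1) → ℕ := fun j => (d (Fin.castLE (Nat.sub_le m 1) j) : ℕ)
  let At : Fin (m - 1) → Fin (k+2) → ℤ := fun j i => (Ator j i).cast
  have hAt : ∀ j i, ((At j i : ℤ) : ZMod (dd j)) = Ator j i := fun j i => ZMod.intCast_zmod_cast _
  let S : Fin (m - 1) → Prop := fun j => m < k + 2 ∨ m - (k + 2) < (j : ℕ)
  -- the orthogonal primitive vector
  let V : Option {j : Fin (m - 1) // S j} → Fin (k+2) → ℤ :=
    fun o => o.elim Afree (fun j => At j.1)
  have hcard : Fintype.card (Option {j : Fin (m - 1) // S j}) < k + 2 := by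
    rw [Fintype.card_option]
    by_cases hm : m < k + 2
    · have := Fintype.card_subtype_le S
      rw [Fintype.card_fin] at this
      omega
    · have : Fintype.card {j : Fin (m - 1) // S j} ≤ Fintype.card (Fin k) := by
        refine Fintype.card_le_of_injective
          (fun j => (⟨(j.1 : ℕ) - (m - (k + 2)) - 1, ?_⟩ : Fin k)) ?_
        · rcases j.2 with h | h
          · omega
          · have := j.1.2; omega
        · rintro ⟨x, hx⟩ ⟨y, hy⟩ hxy
          simp only [Fin.mk.injEq] at hxy
          rcases hx with h | hx
          · omega
          rcases hy with h | hy
          · omega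
          apply Subtype.ext
          apply Fin.ext
          simp only
          omega
      rw [Fintype.card_fin] at this
      omega
  obtain ⟨w, u, hwu, hwV⟩ := aux_orth (k+2) V hcard
  -- the modulus
  let D0 : ℕ := ∏ j, (d j : ℕ)
  have hD0 : D0 ≠ 0 := Finset.prod_ne_zero_iff.mpr fun j _ => (d j).ne_zero
  have hdD0 : ∀ j, (d j : ℕ) ∣ D0 := fun j => Finset.dvd_prod_of_mem _ (Finset.mem_univ j)
  obtain ⟨D, hDD, hD, hS⟩ : ∃ D : ℕ, D ∣ D0 ∧ (D = 1 ∨ D = 2 ∨ D = 3 ∨ D = 4 ∨ D = 6) ∧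
      ∀ j, ¬ S j → dd j ∣ D := by
    rcases hcase with h | ⟨hj, h⟩
    · exact ⟨1, one_dvd _, Or.inl rfl, fun j hj => absurd (Or.inl h) hj⟩
    · refine ⟨_, hdD0 _, h, fun j hjS => hchain _ _ ?_⟩
      rw [Fin.le_def]
      simp only [S, not_or, not_lt] at hjS
      simpa using hjS.2
  have hproj : ∀ (M N : ℕ+) (h : (M : ℕ) ∣ N) (x : ZHat),
      ZMod.castHom h (ZMod M) (ZHat.proj N x) = ZHat.proj M x := fun M N h x => x.2 M N h
  have hinv : ∀ i, ∑ j', ((Φhat⁻¹ : Matrix.GeneralLinearGroup (Fin (k+2)) ZHat) :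
      Matrix (Fin (k+2)) (Fin (k+2)) ZHat) i j' * ((Bfree j' : ℤ) : ZHat) = ((Afree i : ℤ) : ZHat) := by
    have h1 : (Φhat : Matrix (Fin (k+2)) (Fin (k+2)) ZHat) *ᵥ (fun j => ((Afree j : ℤ) : ZHat))
        = fun j => ((Bfree j : ℤ) : ZHat) := funext hfree
    have h2 := congrArg (fun v => ((Φhat⁻¹ : Matrix.GeneralLinearGroup (Fin (k+2)) ZHat) :
      Matrix (Fin (k+2)) (Fin (k+2)) ZHat) *ᵥ v) h1
    simp only [Matrix.mulVec_mulVec] at h2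
    rw [← Units.val_mul, inv_mul_cancel, Units.val_one, Matrix.one_mulVec] at h2
    intro i
    exact (congrFun h2 i).symm
  obtain ⟨Φ, hu, hA, ht⟩ := aux_int k D0 hD0 dd (fun j => hdD0 _) Afree Bfree At Btor S w u hwu
    (hwV none) (fun j hj => hwV (some ⟨j, hj⟩)) D hDD hD hS (by
      intro L hL
      obtain ⟨L', rfl⟩ : ∃ L' : ℕ+, (L' : ℕ) = L := ⟨⟨L, Nat.pos_of_ne_zero hL⟩, rfl⟩
      let lift : Matrix (Fin (k+2)) (Fin (k+2)) ZHat → Matrix (Fin (k+2)) (Fin (k+2)) ℤ :=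
        fun X => Matrix.of fun i j => (ZHat.proj L' (X i j)).cast
      have hlift : ∀ X i j, ((lift X i j : ℤ) : ZMod L') = ZHat.proj L' (X i j) :=
        fun X i j => ZMod.intCast_zmod_cast (ZHat.proj L' (X i j))
      have hdet : ∀ X, (((lift X).det : ℤ) : ZMod L') = ZHat.proj L' X.det := by
        intro X
        have e1 := RingHom.map_det (Int.castRingHom (ZMod L')) (lift X)
        have e2 := RingHom.map_det (ZHat.proj L') X
        have e3 : (Int.castRingHom (ZMod L')).mapMatrix (lift X) = (ZHat.proj L').mapMatrix X := by
          ext i j; exact hlift X i j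
        rw [e2, ← e3]
        exact e1
      have hvec : ∀ X (x y : Fin (k+2) → ℤ),
          (∀ i, ∑ j', X i j' * ((x j' : ℤ) : ZHat) = ((y i : ℤ) : ZHat)) →
          ∀ i, (((lift X *ᵥ x) i : ℤ) : ZMod L') = y i := by
        intro X x y h i
        have := congrArg (ZHat.proj L') (h i)
        rw [map_sum, map_intCast] at this
        simp only [_root_.map_mul, map_intCast] at this
        refine Eq.trans ?_ this
        rw [Matrix.mulVec, dotProduct, Int.cast_sum]
        refine Finset.sum_congr rfl fun j _ => ?_
        rw [Int.cast_mul, hlift]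
      refine ⟨lift Φhat, lift (Φhat⁻¹ : Matrix.GeneralLinearGroup (Fin (k+2)) ZHat), ?_,
        hvec _ _ _ hfree, hvec _ _ _ hinv, ?_⟩
      · rw [Int.cast_mul, hdet, hdet]
        refine ((ZHat.proj L').map_mul _ _).symm.trans ?_
        rw [← Matrix.det_mul, ← Units.val_mul, mul_inv_cancel, Units.val_one, Matrix.det_one]
        exact (ZHat.proj L').map_one
      · intro j hj i
        rw [← htor j i, Matrix.mulVec, dotProduct, Int.cast_sum]
        refine Finset.sum_congr rfl fun l _ => ?_
        rw [Int.cast_mul, hAt]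
        congr 1
        rw [← hproj _ L' hj, ← hlift]
        exact (map_intCast (ZMod.castHom hj (ZMod (dd j))) _).symm)
  refine ⟨Matrix.GeneralLinearGroup.mk'' Φ hu, fun i => congrFun hA i, fun j i => ?_⟩
  rw [← ht j i, Matrix.mulVec, dotProduct, Int.cast_sum]
  refine Finset.sum_congr rfl fun l _ => ?_
  rw [Int.cast_mul, hAt]
  rfl
end
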